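/- Moderate deviation achievability for quantum hypothesis testing: Let ρ, σ be density operators on ℂ^d with supp ρ ⊆ supp σ and relative entropy variance V := V(ρ‖σ) satisfying 0 < V < +∞, and let (a_n) be a sequence of reals with a_n → 0 and a_n·√n → +∞. With r_n := D(ρ‖σ) − a_n, one has limsup_{n→∞} (1/(n·a_n²))·log α̂_{exp(−n·r_n)}(ρ^{⊗n} ‖ σ^{⊗n}) ≤ −1/(2V). -/

import Mathlib

open scoped BigOperators ComplexOrder
open Filter

noncomputable section

namespace MDQ

/-- Functional calculus for Hermitian matrices (junk value `0` otherwise). -/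
noncomputable def matFun {d : ℕ} (f : ℝ → ℝ) (A : Matrix (Fin d) (Fin d) ℂ) :
    Matrix (Fin d) (Fin d) ℂ :=
  if hA : A.IsHermitian then hA.cfc f else 0

/-- Matrix logarithm on the support (`Real.log 0 = 0`). -/
noncomputable def mlog {d : ℕ} (A : Matrix (Fin d) (Fin d) ℂ) : Matrix (Fin d) (Fin d) ℂ :=
  matFun Real.log A

/-- Matrix real power, restricted to the support. -/
noncomputable def mpow {d : ℕ} (A : Matrix (Fin d) (Fin d) ℂ) (p : ℝ) :
    Matrix (Fin d) (Fin d) ℂ :=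
  matFun (fun t => if t = 0 then 0 else t ^ p) A

/-- Matrix exponential via functional calculus. -/
noncomputable def mexp {d : ℕ} (A : Matrix (Fin d) (Fin d) ℂ) : Matrix (Fin d) (Fin d) ℂ :=
  matFun Real.exp A

/-- Orthogonal projection onto the support of a Hermitian matrix. -/
noncomputable def suppProj {d : ℕ} (A : Matrix (Fin d) (Fin d) ℂ) : Matrix (Fin d) (Fin d) ℂ :=
  matFun (fun t => if t = 0 then 0 else 1) A

/-- `A` is a density operator. -/
def IsDensity {d : ℕ} (A : Matrix (Fin d) (Fin d) ℂ) : Prop :=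
  A.PosSemidef ∧ A.trace = 1

/-- Real part of the trace. -/
noncomputable def reTr {ι : Type} [Fintype ι] (A : Matrix ι ι ℂ) : ℝ :=
  A.trace.re

/-- supp ρ ⊆ supp σ, phrased via ranges of the associated linear maps. -/
def SuppLE {d : ℕ} (ρ σ : Matrix (Fin d) (Fin d) ℂ) : Prop :=
  LinearMap.range (Matrix.toLin' ρ) ≤ LinearMap.range (Matrix.toLin' σ)

/-- Quantum relative entropy `D(ρ‖σ)`. -/
noncomputable def qD {d : ℕ} (ρ σ : Matrix (Fin d) (Fin d) ℂ) : ℝ :=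
  reTr (ρ * (mlog ρ - mlog σ))

/-- Quantum relative entropy variance `V(ρ‖σ)`. -/
noncomputable def qV {d : ℕ} (ρ σ : Matrix (Fin d) (Fin d) ℂ) : ℝ :=
  reTr (ρ * (mlog ρ - mlog σ) ^ 2) - (qD ρ σ) ^ 2

/-- The variant relative entropy variance `Ṽ(ρ‖σ)`. -/
noncomputable def qVtilde {d : ℕ} (ρ σ : Matrix (Fin d) (Fin d) ℂ) : ℝ :=
  (∫ t in (0:ℝ)..1,
    reTr (mpow ρ (1 - t) * (mlog ρ - mlog σ) * mpow ρ t * (mlog ρ - mlog σ))) - (qD ρ σ) ^ 2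

/-- The quantum Rényi divergence of order zero, `D₀(ρ‖σ) = -log Tr[Π_ρ σ]`. -/
noncomputable def qD0 {d : ℕ} (ρ σ : Matrix (Fin d) (Fin d) ℂ) : ℝ :=
  - Real.log (reTr (suppProj ρ * σ))

/-- Tensor product of a finite family of `d × d` matrices. -/
noncomputable def tensorSeq {d n : ℕ} (A : Fin n → Matrix (Fin d) (Fin d) ℂ) :
    Matrix (Fin n → Fin d) (Fin n → Fin d) ℂ :=
  Matrix.of fun i j => ∏ k, A k (i k) (j k)

/-- `n`-fold tensor power of a matrix. -/
noncomputable def tensorPow {d : ℕ} (A : Matrix (Fin d) (Fin d) ℂ) (n : ℕ) :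
    Matrix (Fin n → Fin d) (Fin n → Fin d) ℂ :=
  tensorSeq (fun _ => A)

/-- Smallest type-I error with type-II error at most `μ`:  `α̂_μ(ρ‖σ)`. -/
noncomputable def hypoErr {ι : Type} [Fintype ι] [DecidableEq ι]
    (ρ σ : Matrix ι ι ℂ) (μ : ℝ) : ℝ :=
  sInf { a : ℝ | ∃ Q : Matrix ι ι ℂ, Q.PosSemidef ∧ (1 - Q).PosSemidef ∧
    reTr (Q * σ) ≤ μ ∧ a = reTr ((1 - Q) * ρ) }

/-- `P` is a probability distribution on a finite alphabet. -/
def IsProbDist {X : Type} [Fintype X] (P : X → ℝ) : Prop :=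
  (∀ x, 0 ≤ P x) ∧ ∑ x, P x = 1

/-- The average output state `PW`. -/
noncomputable def avgState {X : Type} [Fintype X] {d : ℕ}
    (P : X → ℝ) (W : X → Matrix (Fin d) (Fin d) ℂ) : Matrix (Fin d) (Fin d) ℂ :=
  ∑ x, (P x : ℂ) • W x

/-- Mutual information `I(P, W)`. -/
noncomputable def mutualInfo {X : Type} [Fintype X] {d : ℕ}
    (P : X → ℝ) (W : X → Matrix (Fin d) (Fin d) ℂ) : ℝ :=
  ∑ x, P x * qD (W x) (avgState P W)

/-- Capacity `C_W`. -/
noncomputable def capacity {X : Type} [Fintype X] {d : ℕ}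
    (W : X → Matrix (Fin d) (Fin d) ℂ) : ℝ :=
  sSup { c : ℝ | ∃ P : X → ℝ, IsProbDist P ∧ c = mutualInfo P W }

/-- Conditional information variance `V(P, W)`. -/
noncomputable def infoVar {X : Type} [Fintype X] {d : ℕ}
    (P : X → ℝ) (W : X → Matrix (Fin d) (Fin d) ℂ) : ℝ :=
  ∑ x, P x * qV (W x) (avgState P W)

/-- The variant conditional information variance `Ṽ(P, W)`. -/
noncomputable def infoVarTilde {X : Type} [Fintype X] {d : ℕ}
    (P : X → ℝ) (W : X → Matrix (Fin d) (Fin d) ℂ) : ℝ :=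
  ∑ x, P x * qVtilde (W x) (avgState P W)

/-- Minimal peripheral information variance `V_W`. -/
noncomputable def Vmin {X : Type} [Fintype X] {d : ℕ}
    (W : X → Matrix (Fin d) (Fin d) ℂ) : ℝ :=
  sInf { v : ℝ | ∃ P : X → ℝ, IsProbDist P ∧ mutualInfo P W = capacity W ∧ v = infoVar P W }

/-- Minimal variant peripheral information variance `Ṽ_W`. -/
noncomputable def VminTilde {X : Type} [Fintype X] {d : ℕ}
    (W : X → Matrix (Fin d) (Fin d) ℂ) : ℝ :=
  sInf { v : ℝ | ∃ P : X → ℝ, IsProbDist P ∧ mutualInfo P W = capacity W ∧ v = infoVarTilde P W }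

/-- Conditional relative entropy `D(W‖σ|P)`. -/
noncomputable def Dcond {X : Type} [Fintype X] {d : ℕ}
    (W : X → Matrix (Fin d) (Fin d) ℂ) (σ : Matrix (Fin d) (Fin d) ℂ) (P : X → ℝ) : ℝ :=
  ∑ x, P x * qD (W x) σ

/-- Conditional relative entropy variance `V(W‖σ|P)`. -/
noncomputable def Vcond {X : Type} [Fintype X] {d : ℕ}
    (W : X → Matrix (Fin d) (Fin d) ℂ) (σ : Matrix (Fin d) (Fin d) ℂ) (P : X → ℝ) : ℝ :=
  ∑ x, P x * qV (W x) σ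

/-- Conditional order-zero Rényi divergence `D₀(W‖σ|P)`. -/
noncomputable def D0cond {X : Type} [Fintype X] {d : ℕ}
    (W : X → Matrix (Fin d) (Fin d) ℂ) (σ : Matrix (Fin d) (Fin d) ℂ) (P : X → ℝ) : ℝ :=
  ∑ x, P x * qD0 (W x) σ

/-- The exponent function `E_h(s, P, σ)`. -/
noncomputable def Eh {X : Type} [Fintype X] {d : ℕ}
    (W : X → Matrix (Fin d) (Fin d) ℂ) (s : ℝ) (P : X → ℝ)
    (σ : Matrix (Fin d) (Fin d) ℂ) : ℝ :=
  -(1 + s) * ∑ x, P x * Real.log (reTr (mpow (W x) (1 / (1 + s)) * mpow σ (s / (1 + s))))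

/-- The log-Euclidean exponent function `Ẽ_h(s, P, σ)`. -/
noncomputable def EhTilde {X : Type} [Fintype X] {d : ℕ}
    (W : X → Matrix (Fin d) (Fin d) ℂ) (s : ℝ) (P : X → ℝ)
    (σ : Matrix (Fin d) (Fin d) ℂ) : ℝ :=
  -(1 + s) * ∑ x, P x *
    Real.log (reTr (mexp ((((1 + s)⁻¹ : ℝ) : ℂ) • (mlog (W x) + ((s : ℝ) : ℂ) • mlog σ))))

/-- The modified auxiliary function `Ẽ₀(s, P, σ)`. -/
noncomputable def E0Tilde {X : Type} [Fintype X] {d : ℕ}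
    (W : X → Matrix (Fin d) (Fin d) ℂ) (s : ℝ) (P : X → ℝ)
    (σ : Matrix (Fin d) (Fin d) ℂ) : ℝ :=
  - Real.log (∑ x, P x * reTr (mpow (W x) (1 - s) * mpow σ s))

/-- The sphere-packing exponent `E_sp^{(2)}(R, P, σ)`. -/
noncomputable def Esp2 {X : Type} [Fintype X] {d : ℕ}
    (W : X → Matrix (Fin d) (Fin d) ℂ) (R : ℝ) (P : X → ℝ)
    (σ : Matrix (Fin d) (Fin d) ℂ) : ℝ :=
  sSup { e : ℝ | ∃ s : ℝ, 0 ≤ s ∧ e = Eh W s P σ - s * R }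

/-- The sphere-packing exponent `Ẽ_sp(R, P, σ)`. -/
noncomputable def EspTilde {X : Type} [Fintype X] {d : ℕ}
    (W : X → Matrix (Fin d) (Fin d) ℂ) (R : ℝ) (P : X → ℝ)
    (σ : Matrix (Fin d) (Fin d) ℂ) : ℝ :=
  sSup { e : ℝ | ∃ s : ℝ, 0 ≤ s ∧ e = EhTilde W s P σ - s * R }

open Classical in
/-- Empirical distribution of a word `x^n ∈ X^n`. -/
noncomputable def empDist {X : Type} [Fintype X] {n : ℕ} (xs : Fin n → X) (x : X) : ℝ :=
  ((Finset.univ.filter fun i => xs i = x).card : ℝ) / n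

/-- Smallest average error probability `ε*(n, R)` over all `n`-blocklength codes with
`⌈exp (n R)⌉` messages. -/
noncomputable def optErr {X : Type} [Fintype X] {d : ℕ}
    (W : X → Matrix (Fin d) (Fin d) ℂ) (n : ℕ) (R : ℝ) : ℝ :=
  sInf { e : ℝ | ∃ (f : Fin ⌈Real.exp (n * R)⌉₊ → Fin n → X)
    (Pov : Fin ⌈Real.exp (n * R)⌉₊ → Matrix (Fin n → Fin d) (Fin n → Fin d) ℂ),
    (∀ m, (Pov m).PosSemidef) ∧ (∑ m, Pov m) = 1 ∧
    e = (1 / (⌈Real.exp (n * R)⌉₊ : ℝ)) *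
      ∑ m, (1 - reTr (Pov m * tensorSeq (fun k => W (f m k)))) }

/-- The binary entropy function. -/
noncomputable def binEnt (p : ℝ) : ℝ :=
  -p * Real.log p - (1 - p) * Real.log (1 - p)

section Spectral

variable {ι : Type} [Fintype ι]

/-- Squared overlap of the `x`-th column of `U` with the `y`-th column of `W`. -/
def overlap (U W : Matrix ι ι ℂ) (x y : ι) : ℝ :=
  Complex.normSq ((W.conjTranspose * U) y x)

lemma overlap_nonneg (U W : Matrix ι ι ℂ) (x y : ι) : 0 ≤ overlap U W x y :=
  Complex.normSq_nonneg _

lemma reTr_add (A B : Matrix ι ι ℂ) : reTr (A + B) = reTr A + reTr B := by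
  simp [reTr, Matrix.trace_add]

lemma reTr_sub (A B : Matrix ι ι ℂ) : reTr (A - B) = reTr A - reTr B := by
  simp [reTr, Matrix.trace_sub]

lemma reTr_mul_comm (A B : Matrix ι ι ℂ) : reTr (A * B) = reTr (B * A) := by
  rw [reTr, reTr, Matrix.trace_mul_comm]

variable [DecidableEq ι]

/-- The matrix `U diag(f) Uᴴ`. -/
def conjDiag (U : Matrix ι ι ℂ) (f : ι → ℝ) : Matrix ι ι ℂ :=
  U * Matrix.diagonal (fun i => (f i : ℂ)) * U.conjTranspose

lemma isHermitian_conjDiag (U : Matrix ι ι ℂ) (f : ι → ℝ) : (conjDiag U f).IsHermitian :=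
  Matrix.isHermitian_mul_mul_conjTranspose U
    (Matrix.isHermitian_diagonal_of_self_adjoint _ (by ext i; simp))

lemma posSemidef_conjDiag (U : Matrix ι ι ℂ) {f : ι → ℝ} (hf : ∀ i, 0 ≤ f i) :
    (conjDiag U f).PosSemidef :=
  Matrix.PosSemidef.mul_mul_conjTranspose_same
    (Matrix.PosSemidef.diagonal fun i => by simpa using hf i) U

lemma conjDiag_sub (U : Matrix ι ι ℂ) (f g : ι → ℝ) :
    conjDiag U f - conjDiag U g = conjDiag U (fun i => f i - g i) := by
  simp only [conjDiag, ← Matrix.sub_mul, ← Matrix.mul_sub, Matrix.diagonal_sub]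
  congr 3; ext i; simp

lemma smul_conjDiag (U : Matrix ι ι ℂ) (t : ℝ) (f : ι → ℝ) :
    (t : ℂ) • conjDiag U f = conjDiag U (fun i => t * f i) := by
  rw [conjDiag, ← Matrix.smul_mul, ← Matrix.mul_smul, ← Matrix.diagonal_smul]
  simp [conjDiag, Pi.smul_def]

lemma conjDiag_mul {U : Matrix ι ι ℂ} (hU : U ∈ Matrix.unitaryGroup ι ℂ) (f g : ι → ℝ) :
    conjDiag U f * conjDiag U g = conjDiag U (fun i => f i * g i) := by
  have h : U.conjTranspose * U = 1 := Matrix.mem_unitaryGroup_iff'.1 hU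
  calc conjDiag U f * conjDiag U g
      = U * Matrix.diagonal (fun i => (f i : ℂ)) * (U.conjTranspose * U) *
          Matrix.diagonal (fun i => (g i : ℂ)) * U.conjTranspose := by
        simp only [conjDiag, Matrix.mul_assoc]
    _ = _ := by
        rw [h, Matrix.mul_one, Matrix.mul_assoc U, Matrix.diagonal_mul_diagonal]
        simp [conjDiag]

lemma conjDiag_one {U : Matrix ι ι ℂ} (hU : U ∈ Matrix.unitaryGroup ι ℂ) :
    conjDiag U (fun _ => 1) = 1 := by
  have h : U * U.conjTranspose = 1 := Matrix.mem_unitaryGroup_iff.1 hU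
  simp [conjDiag, h]

lemma _root_.Matrix.IsHermitian.exists_eq_conjDiag {A : Matrix ι ι ℂ} (hA : A.IsHermitian) :
    ∃ U ∈ Matrix.unitaryGroup ι ℂ, A = conjDiag U hA.eigenvalues ∧
      ∀ f : ℝ → ℝ, hA.cfc f = conjDiag U (fun i => f (hA.eigenvalues i)) := by
  refine ⟨hA.eigenvectorUnitary, hA.eigenvectorUnitary.2, ?_, fun f => ?_⟩
  · conv_lhs => rw [hA.spectral_theorem]
    rfl
  · rfl

lemma reTr_conjDiag_mul_conjTranspose_mul {W : Matrix ι ι ℂ} (hW : W ∈ Matrix.unitaryGroup ι ℂ)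
    (U X : Matrix ι ι ℂ) (l : ι → ℝ) :
    reTr (conjDiag U l * (X.conjTranspose * X)) =
      ∑ x, ∑ y, l x * Complex.normSq ((W.conjTranspose * X * U) y x) := by
  have h : W * W.conjTranspose = 1 := Matrix.mem_unitaryGroup_iff.1 hW
  have key : (conjDiag U l * (X.conjTranspose * X)).trace =
      (Matrix.diagonal (fun i => (l i : ℂ)) * ((W.conjTranspose * X * U).conjTranspose *
        (W.conjTranspose * X * U))).trace := by
    rw [conjDiag, Matrix.mul_assoc, Matrix.mul_assoc, Matrix.trace_mul_comm]
    congr 1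
    simp only [Matrix.conjTranspose_mul, Matrix.conjTranspose_conjTranspose, Matrix.mul_assoc]
    rw [← Matrix.mul_assoc W, h, Matrix.one_mul]
  rw [reTr, key, Matrix.trace, Complex.re_sum]
  refine Finset.sum_congr rfl fun x _ => ?_
  rw [Matrix.diag_apply, Matrix.diagonal_mul, Matrix.mul_apply, Finset.mul_sum, Complex.re_sum]
  refine Finset.sum_congr rfl fun y _ => ?_
  rw [Matrix.conjTranspose_apply, Complex.star_def, ← Complex.normSq_eq_conj_mul_self,
    ← Complex.ofReal_mul, Complex.ofReal_re]

lemma reTr_conjDiag_mul_conjDiag (U W : Matrix ι ι ℂ) (f g : ι → ℝ) :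
    reTr (conjDiag U f * conjDiag W g) = ∑ x, ∑ y, f x * g y * overlap U W x y := by
  have key : (conjDiag U f * conjDiag W g).trace =
      (Matrix.diagonal (fun i => (f i : ℂ)) * ((W.conjTranspose * U).conjTranspose *
        (Matrix.diagonal (fun i => (g i : ℂ)) * (W.conjTranspose * U)))).trace := by
    rw [conjDiag, conjDiag, Matrix.mul_assoc, Matrix.mul_assoc, Matrix.trace_mul_comm]
    simp only [Matrix.conjTranspose_mul, Matrix.conjTranspose_conjTranspose, Matrix.mul_assoc]
  rw [reTr, key, Matrix.trace, Complex.re_sum]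
  refine Finset.sum_congr rfl fun x _ => ?_
  rw [Matrix.diag_apply, Matrix.diagonal_mul, Matrix.mul_apply, Finset.mul_sum, Complex.re_sum]
  refine Finset.sum_congr rfl fun y _ => ?_
  rw [Matrix.conjTranspose_apply, Complex.star_def, Matrix.diagonal_mul, overlap,
    mul_left_comm _ (g y : ℂ), ← Complex.normSq_eq_conj_mul_self,
    ← Complex.ofReal_mul, ← Complex.ofReal_mul, Complex.ofReal_re, mul_assoc]

lemma reTr_mul_nonneg {A B : Matrix ι ι ℂ} (hA : A.PosSemidef) (hB : B.PosSemidef) :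
    0 ≤ reTr (A * B) := by
  obtain ⟨U, -, h, -⟩ := hA.isHermitian.exists_eq_conjDiag
  obtain ⟨W, -, h', -⟩ := hB.isHermitian.exists_eq_conjDiag
  rw [h, h', reTr_conjDiag_mul_conjDiag]
  exact Finset.sum_nonneg fun x _ => Finset.sum_nonneg fun y _ =>
    mul_nonneg (mul_nonneg (hA.eigenvalues_nonneg x) (hB.eigenvalues_nonneg y))
      (overlap_nonneg _ _ _ _)

lemma posSemidef_sub_sq {Q : Matrix ι ι ℂ} (hQ : Q.PosSemidef) (hQ' : (1 - Q).PosSemidef) :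
    (Q - Q * Q).PosSemidef := by
  have h1 := hQ.mul_mul_conjTranspose_same (1 - Q)
  have h2 := hQ'.mul_mul_conjTranspose_same Q
  rw [hQ.isHermitian.eq] at h2
  rw [hQ'.isHermitian.eq] at h1
  have := h1.add h2
  convert this using 1
  noncomm_ring

/-- Nussbaum–Szkoła lower bound on the errors of a quantum test. -/
lemma sum_min_le_test_error {U W Q : Matrix ι ι ℂ} (hU : U ∈ Matrix.unitaryGroup ι ℂ)
    (hW : W ∈ Matrix.unitaryGroup ι ℂ) {l m : ι → ℝ} (hl : ∀ i, 0 ≤ l i) (hm : ∀ i, 0 ≤ m i)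
    (hQ : Q.PosSemidef) (hQ' : (1 - Q).PosSemidef) :
    (∑ x, ∑ y, min (l x) (m y) * overlap U W x y) / 2 ≤
      reTr ((1 - Q) * conjDiag U l) + reTr (Q * conjDiag W m) := by
  have h1 : ∑ x, ∑ y, l x * Complex.normSq ((W.conjTranspose * (1 - Q) * U) y x) ≤
      reTr ((1 - Q) * conjDiag U l) := by
    rw [← reTr_conjDiag_mul_conjTranspose_mul hW, hQ'.isHermitian.eq, reTr_mul_comm (1 - Q),
      ← sub_nonneg, ← reTr_sub, ← Matrix.mul_sub]
    exact reTr_mul_nonneg (posSemidef_conjDiag U hl)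
      (posSemidef_sub_sq hQ' (by simpa using hQ))
  have h2 : ∑ x, ∑ y, m y * Complex.normSq ((W.conjTranspose * Q * U) y x) ≤
      reTr (Q * conjDiag W m) := by
    have : ∑ x, ∑ y, m y * Complex.normSq ((W.conjTranspose * Q * U) y x) =
        reTr (conjDiag W m * (Q.conjTranspose * Q)) := by
      rw [reTr_conjDiag_mul_conjTranspose_mul hU, Finset.sum_comm]
      refine Finset.sum_congr rfl fun x _ => Finset.sum_congr rfl fun y _ => ?_
      rw [← Complex.normSq_conj, ← Complex.star_def, ← Matrix.conjTranspose_apply]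
      simp only [Matrix.conjTranspose_mul, Matrix.conjTranspose_conjTranspose, Matrix.mul_assoc,
        hQ.isHermitian.eq]
    rw [this, hQ.isHermitian.eq, reTr_mul_comm Q,
      ← sub_nonneg, ← reTr_sub, ← Matrix.mul_sub]
    exact reTr_mul_nonneg (posSemidef_conjDiag W hm) (posSemidef_sub_sq hQ hQ')
  refine le_trans ?_ (add_le_add h1 h2)
  rw [Finset.sum_div, ← Finset.sum_add_distrib]
  refine Finset.sum_le_sum fun x _ => ?_
  rw [Finset.sum_div, ← Finset.sum_add_distrib]
  refine Finset.sum_le_sum fun y _ => ?_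
  set p := (W.conjTranspose * (1 - Q) * U) y x
  set q := (W.conjTranspose * Q * U) y x
  have hpq : overlap U W x y = Complex.normSq (p + q) := by
    have : W.conjTranspose * U = W.conjTranspose * (1 - Q) * U + W.conjTranspose * Q * U := by
      noncomm_ring
    rw [overlap, this, Matrix.add_apply]
  have h3 : Complex.normSq (p + q) ≤ 2 * (Complex.normSq p + Complex.normSq q) := by
    simp only [Complex.normSq_apply, Complex.add_re, Complex.add_im]
    nlinarith [sq_nonneg (p.re - q.re), sq_nonneg (p.im - q.im)]
  rw [hpq]
  have h4 := min_le_left (l x) (m y)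
  have h5 := min_le_right (l x) (m y)
  have h6 := le_min (hl x) (hm y)
  nlinarith [mul_le_mul_of_nonneg_left h3 h6,
    mul_le_mul_of_nonneg_right h4 (Complex.normSq_nonneg p),
    mul_le_mul_of_nonneg_right h5 (Complex.normSq_nonneg q)]

end Spectral

section Chernoff

open scoped MatrixOrder Matrix.Norms.L2Operator

variable {ι : Type} [Fintype ι] [DecidableEq ι]

lemma conjDiag_comp_eq {U W : Matrix ι ι ℂ} (hU : U ∈ Matrix.unitaryGroup ι ℂ)
    (hW : W ∈ Matrix.unitaryGroup ι ℂ) {l m : ι → ℝ} (h : conjDiag U l = conjDiag W m)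
    (f : ℝ → ℝ) : conjDiag U (fun i => f (l i)) = conjDiag W (fun i => f (m i)) := by
  have hU1 : U.conjTranspose * U = 1 := Matrix.mem_unitaryGroup_iff'.1 hU
  have hU2 : U * U.conjTranspose = 1 := Matrix.mem_unitaryGroup_iff.1 hU
  have hW1 : W.conjTranspose * W = 1 := Matrix.mem_unitaryGroup_iff'.1 hW
  have hW2 : W * W.conjTranspose = 1 := Matrix.mem_unitaryGroup_iff.1 hW
  have left (g : ι → ℝ) : W.conjTranspose * conjDiag U g * U =
      W.conjTranspose * U * Matrix.diagonal (fun i => (g i : ℂ)) := by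
    rw [conjDiag, ← Matrix.mul_assoc, Matrix.mul_assoc _ U.conjTranspose, hU1, Matrix.mul_one,
      ← Matrix.mul_assoc]
  have right (g : ι → ℝ) : W.conjTranspose * conjDiag W g * U =
      Matrix.diagonal (fun i => (g i : ℂ)) * (W.conjTranspose * U) := by
    rw [conjDiag, ← Matrix.mul_assoc, ← Matrix.mul_assoc, hW1, Matrix.one_mul, Matrix.mul_assoc]
  have cancel {X Y : Matrix ι ι ℂ} (hXY : W.conjTranspose * X * U = W.conjTranspose * Y * U) :
      X = Y := by
    have := congrArg (fun Z => W * Z * U.conjTranspose) hXY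
    simpa [← Matrix.mul_assoc, hW2, Matrix.mul_assoc _ U, hU2] using this
  apply cancel
  have h' : W.conjTranspose * conjDiag U l * U = W.conjTranspose * conjDiag W m * U := by rw [h]
  rw [left, right] at h' ⊢
  ext y x
  have hyx := congrFun (congrFun h' y) x
  rw [Matrix.mul_diagonal, Matrix.diagonal_mul] at hyx ⊢
  by_cases h0 : (W.conjTranspose * U) y x = 0
  · simp [h0]
  · have : (l x : ℂ) = m y := mul_left_cancel₀ h0 (by rw [hyx, mul_comm])
    rw [Complex.ofReal_injective this, mul_comm]

lemma rpow_conjDiag {U : Matrix ι ι ℂ} (hU : U ∈ Matrix.unitaryGroup ι ℂ) {l : ι → ℝ}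
    (hl : ∀ i, 0 ≤ l i) (s : ℝ) :
    (conjDiag U l) ^ s = conjDiag U (fun i => l i ^ s) := by
  have h0 : 0 ≤ conjDiag U l := Matrix.nonneg_iff_posSemidef.2 (posSemidef_conjDiag U hl)
  have hA := isHermitian_conjDiag U l
  obtain ⟨W, hW, h, hf⟩ := hA.exists_eq_conjDiag
  rw [CFC.rpow_eq_cfc_real h0, hA.cfc_eq, hf]
  exact (conjDiag_comp_eq hU hW h (fun x => x ^ s)).symm

/-- Löwner–Heinz monotonicity in diagonalized form. -/
lemma posSemidef_conjDiag_rpow_sub {U W : Matrix ι ι ℂ} (hU : U ∈ Matrix.unitaryGroup ι ℂ)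
    (hW : W ∈ Matrix.unitaryGroup ι ℂ) {l m : ι → ℝ} (hl : ∀ i, 0 ≤ l i) (hm : ∀ i, 0 ≤ m i)
    (h : (conjDiag W m - conjDiag U l).PosSemidef) {s : ℝ} (hs : s ∈ Set.Icc (0 : ℝ) 1) :
    (conjDiag W (fun i => m i ^ s) - conjDiag U (fun i => l i ^ s)).PosSemidef := by
  rw [← rpow_conjDiag hU hl, ← rpow_conjDiag hW hm]
  exact CFC.rpow_le_rpow hs (show conjDiag U l ≤ conjDiag W m from h)

/-- The quantum Chernoff inequality: the test onto the positive part of `A - B` has total error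
at most `Tr A^(1-s) B^s`. -/
lemma exists_test_error_le {U W : Matrix ι ι ℂ} (hU : U ∈ Matrix.unitaryGroup ι ℂ)
    (hW : W ∈ Matrix.unitaryGroup ι ℂ) {l m : ι → ℝ} (hl : ∀ i, 0 ≤ l i) (hm : ∀ i, 0 ≤ m i)
    {s : ℝ} (hs : s ∈ Set.Icc (0 : ℝ) 1) :
    ∃ Q : Matrix ι ι ℂ, Q.PosSemidef ∧ (1 - Q).PosSemidef ∧
      reTr ((1 - Q) * conjDiag U l) + reTr (Q * conjDiag W m) ≤
        ∑ x, ∑ y, l x ^ (1 - s) * m y ^ s * overlap U W x y := by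
  have hAB := (isHermitian_conjDiag U l).sub (isHermitian_conjDiag W m)
  obtain ⟨E, hE, hdiff, -⟩ := hAB.exists_eq_conjDiag
  set e := hAB.eigenvalues
  set Q := conjDiag E (fun i => if 0 < e i then 1 else 0)
  have hQ : Q.PosSemidef := posSemidef_conjDiag E fun i => by split_ifs <;> norm_num
  have hQ' : (1 - Q).PosSemidef := by
    rw [← conjDiag_one hE, conjDiag_sub]
    exact posSemidef_conjDiag E fun i => by split_ifs <;> norm_num
  refine ⟨Q, hQ, hQ', ?_⟩
  set P := conjDiag E (fun i => max (e i) 0)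
  have hP : P.PosSemidef := posSemidef_conjDiag E fun i => le_max_right _ _
  have hQP : Q * (conjDiag U l - conjDiag W m) = P := by
    rw [hdiff, conjDiag_mul hE]
    congr 1; ext i
    split_ifs with h
    · rw [one_mul, max_eq_left h.le]
    · rw [zero_mul, max_eq_right (not_lt.1 h)]
  have hD : (conjDiag W m + P).PosSemidef := (posSemidef_conjDiag W hm).add hP
  obtain ⟨T, hT, hDT, -⟩ := hD.isHermitian.exists_eq_conjDiag
  have ht : ∀ i, 0 ≤ hD.isHermitian.eigenvalues i := hD.eigenvalues_nonneg
  set t := hD.isHermitian.eigenvalues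
  have hBD : (conjDiag T t - conjDiag W m).PosSemidef := by
    rw [← hDT, add_sub_cancel_left]; exact hP
  have hAD : (conjDiag T t - conjDiag U l).PosSemidef := by
    have h1 : conjDiag T t - conjDiag U l = P - (conjDiag U l - conjDiag W m) := by
      rw [← hDT]; abel
    rw [h1, hdiff, conjDiag_sub]
    exact posSemidef_conjDiag E fun i => sub_nonneg.2 (le_max_left _ _)
  have hs' : 1 - s ∈ Set.Icc (0 : ℝ) 1 := ⟨by linarith [hs.2], by linarith [hs.1]⟩
  have split {X : Matrix ι ι ℂ} (hX : X ∈ Matrix.unitaryGroup ι ℂ) {f : ι → ℝ}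
      (hf : ∀ i, 0 ≤ f i) :
      conjDiag X (fun i => f i ^ s) * conjDiag X (fun i => f i ^ (1 - s)) = conjDiag X f := by
    rw [conjDiag_mul hX]
    congr 1; ext i
    rw [← Real.rpow_add' (hf i) (by norm_num), add_sub_cancel, Real.rpow_one]
  have pow_nonneg (X : Matrix ι ι ℂ) {f : ι → ℝ} (hf : ∀ i, 0 ≤ f i) (r : ℝ) :
      (conjDiag X (fun i => f i ^ r)).PosSemidef :=
    posSemidef_conjDiag X fun i => Real.rpow_nonneg (hf i) r
  have e1 := reTr_mul_nonneg (posSemidef_conjDiag_rpow_sub hU hT hl ht hAD hs)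
    (pow_nonneg U hl (1 - s))
  have e2 := reTr_mul_nonneg (posSemidef_conjDiag_rpow_sub hW hT hm ht hBD hs)
    (posSemidef_conjDiag_rpow_sub hU hT hl ht hAD hs')
  have e3 := reTr_mul_nonneg (pow_nonneg W hm s)
    (posSemidef_conjDiag_rpow_sub hW hT hm ht hBD hs')
  simp only [Matrix.mul_sub, Matrix.sub_mul, reTr_sub, split hU hl, split hW hm, split hT ht]
    at e1 e2 e3
  have f1 : reTr (Q * conjDiag U l) - reTr (Q * conjDiag W m) = reTr P := by
    rw [← reTr_sub, ← Matrix.mul_sub, hQP]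
  have f2 : reTr (conjDiag T t) = reTr (conjDiag W m) + reTr P := by rw [← hDT, reTr_add]
  rw [Matrix.sub_mul, Matrix.one_mul, reTr_sub, ← reTr_conjDiag_mul_conjDiag,
    reTr_mul_comm (conjDiag U _)]
  linarith

end Chernoff

section TensorPower

variable {d : ℕ}

lemma tensorPow_mul (A B : Matrix (Fin d) (Fin d) ℂ) (n : ℕ) :
    tensorPow (A * B) n = tensorPow A n * tensorPow B n := by
  ext i j
  simp only [tensorPow, tensorSeq, Matrix.of_apply, Matrix.mul_apply, Finset.prod_univ_sum,
    Fintype.piFinset_univ, Finset.prod_mul_distrib]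

lemma tensorPow_conjTranspose (A : Matrix (Fin d) (Fin d) ℂ) (n : ℕ) :
    tensorPow A.conjTranspose n = (tensorPow A n).conjTranspose := by
  ext i j
  simp [tensorPow, tensorSeq, Matrix.conjTranspose_apply]

lemma tensorPow_diagonal (v : Fin d → ℂ) (n : ℕ) :
    tensorPow (Matrix.diagonal v) n = Matrix.diagonal (fun i => ∏ k, v (i k)) := by
  ext i j
  simp only [tensorPow, tensorSeq, Matrix.of_apply]
  by_cases h : i = j
  · subst h
    simp
  · obtain ⟨k, hk⟩ := Function.ne_iff.1 h
    rw [Matrix.diagonal_apply_ne _ h]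
    exact Finset.prod_eq_zero (Finset.mem_univ k) (Matrix.diagonal_apply_ne _ hk)

lemma tensorPow_mem_unitaryGroup {U : Matrix (Fin d) (Fin d) ℂ}
    (hU : U ∈ Matrix.unitaryGroup (Fin d) ℂ) (n : ℕ) :
    tensorPow U n ∈ Matrix.unitaryGroup (Fin n → Fin d) ℂ := by
  have h : U * U.conjTranspose = 1 := Matrix.mem_unitaryGroup_iff.1 hU
  rw [Matrix.mem_unitaryGroup_iff, Matrix.star_eq_conjTranspose, ← tensorPow_conjTranspose,
    ← tensorPow_mul, h, ← Matrix.diagonal_one, tensorPow_diagonal]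
  simp

lemma tensorPow_conjDiag (U : Matrix (Fin d) (Fin d) ℂ) (l : Fin d → ℝ) (n : ℕ) :
    tensorPow (conjDiag U l) n = conjDiag (tensorPow U n) (fun i => ∏ k, l (i k)) := by
  rw [conjDiag, tensorPow_mul, tensorPow_mul, tensorPow_conjTranspose, tensorPow_diagonal]
  simp [conjDiag]

lemma overlap_tensorPow (U W : Matrix (Fin d) (Fin d) ℂ) (n : ℕ) (x y : Fin n → Fin d) :
    overlap (tensorPow U n) (tensorPow W n) x y = ∏ k, overlap U W (x k) (y k) := by
  rw [overlap, ← tensorPow_conjTranspose, ← tensorPow_mul]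
  simp [tensorPow, tensorSeq, overlap]

lemma sum_sum_prod (g : Fin d → Fin d → ℝ) (n : ℕ) :
    ∑ x : Fin n → Fin d, ∑ y : Fin n → Fin d, ∏ k, g (x k) (y k) =
      (∑ x, ∑ y, g x y) ^ n := by
  have h1 (x : Fin n → Fin d) :
      ∑ y : Fin n → Fin d, ∏ k, g (x k) (y k) = ∏ k, ∑ y, g (x k) y := by
    rw [Finset.prod_univ_sum, Fintype.piFinset_univ]
  have h2 : (∑ x, ∑ y, g x y) ^ n = ∏ _k : Fin n, ∑ x, ∑ y, g x y := by simp
  rw [h2, Finset.prod_univ_sum, Fintype.piFinset_univ]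
  exact Finset.sum_congr rfl fun x _ => h1 x

end TensorPower

section NussbaumSzkola

variable {d : ℕ}

lemma overlap_eq_zero_of_suppLE {U W : Matrix (Fin d) (Fin d) ℂ}
    (hU : U ∈ Matrix.unitaryGroup (Fin d) ℂ) (hW : W ∈ Matrix.unitaryGroup (Fin d) ℂ)
    {l m : Fin d → ℝ} (h : SuppLE (conjDiag U l) (conjDiag W m)) {x y : Fin d}
    (hx : l x ≠ 0) (hy : m y = 0) : overlap U W x y = 0 := by
  have hU1 : U.conjTranspose * U = 1 := Matrix.mem_unitaryGroup_iff'.1 hU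
  have hW1 : W.conjTranspose * W = 1 := Matrix.mem_unitaryGroup_iff'.1 hW
  obtain ⟨v, hv⟩ := h ⟨U.mulVec (Pi.single x 1), rfl⟩
  rw [Matrix.toLin'_apply, Matrix.toLin'_apply] at hv
  have h1 := congrFun (congrArg (W.conjTranspose.mulVec) hv) y
  rw [Matrix.mulVec_mulVec, Matrix.mulVec_mulVec, Matrix.mulVec_mulVec, conjDiag, conjDiag,
    ← Matrix.mul_assoc, ← Matrix.mul_assoc, hW1, Matrix.one_mul, ← Matrix.mulVec_mulVec,
    Matrix.mulVec_diagonal, hy, Matrix.mul_assoc W.conjTranspose, Matrix.mul_assoc _ _ U, hU1,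
    Matrix.mul_one, ← Matrix.mul_assoc, Matrix.mulVec_single_one, Matrix.col_apply,
    Matrix.mul_diagonal] at h1
  simp only [Complex.ofReal_zero, zero_mul, zero_eq_mul, Complex.ofReal_eq_zero, hx,
    or_false] at h1
  rw [overlap, h1, map_zero]

/-- Relative entropy as the mean log-likelihood ratio of the Nussbaum–Szkoła pair. -/
lemma reTr_mul_sub_conjDiag {U W : Matrix (Fin d) (Fin d) ℂ}
    (hU : U ∈ Matrix.unitaryGroup (Fin d) ℂ) (hW : W ∈ Matrix.unitaryGroup (Fin d) ℂ)
    (l f g : Fin d → ℝ) :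
    reTr (conjDiag U l * (conjDiag U f - conjDiag W g)) =
      ∑ x, ∑ y, l x * overlap U W x y * (f x - g y) := by
  have h : reTr (conjDiag U l * conjDiag U f) = ∑ x, ∑ y, l x * f x * overlap U W x y := by
    have := reTr_conjDiag_mul_conjDiag U W (fun i => l i * f i) (fun _ => 1)
    simpa only [conjDiag_one hW, Matrix.mul_one, ← conjDiag_mul hU, mul_one] using this
  rw [Matrix.mul_sub, reTr_sub, h, reTr_conjDiag_mul_conjDiag]
  simp only [← Finset.sum_sub_distrib]
  exact Finset.sum_congr rfl fun x _ => Finset.sum_congr rfl fun y _ => by ring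

lemma reTr_mul_sub_sq_conjDiag {U W : Matrix (Fin d) (Fin d) ℂ}
    (hU : U ∈ Matrix.unitaryGroup (Fin d) ℂ) (hW : W ∈ Matrix.unitaryGroup (Fin d) ℂ)
    (l f g : Fin d → ℝ) :
    reTr (conjDiag U l * (conjDiag U f - conjDiag W g) ^ 2) =
      ∑ x, ∑ y, l x * overlap U W x y * (f x - g y) ^ 2 := by
  have hU1 : U.conjTranspose * U = 1 := Matrix.mem_unitaryGroup_iff'.1 hU
  have hW1 : W.conjTranspose * W = 1 := Matrix.mem_unitaryGroup_iff'.1 hW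
  have hX := (isHermitian_conjDiag U f).sub (isHermitian_conjDiag W g)
  have key : W.conjTranspose * (conjDiag U f - conjDiag W g) * U =
      W.conjTranspose * U * Matrix.diagonal (fun i => (f i : ℂ)) -
        Matrix.diagonal (fun i => (g i : ℂ)) * (W.conjTranspose * U) := by
    rw [Matrix.mul_sub, Matrix.sub_mul]
    congr 1
    · rw [conjDiag, ← Matrix.mul_assoc, Matrix.mul_assoc _ U.conjTranspose, hU1, Matrix.mul_one,
        ← Matrix.mul_assoc]
    · rw [conjDiag, ← Matrix.mul_assoc, ← Matrix.mul_assoc, hW1, Matrix.one_mul, Matrix.mul_assoc]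
  have hsq : (conjDiag U f - conjDiag W g) ^ 2 =
      (conjDiag U f - conjDiag W g).conjTranspose * (conjDiag U f - conjDiag W g) := by
    rw [hX.eq, sq]
  rw [hsq, reTr_conjDiag_mul_conjTranspose_mul hW, key]
  refine Finset.sum_congr rfl fun x _ => Finset.sum_congr rfl fun y _ => ?_
  rw [Matrix.sub_apply, Matrix.mul_diagonal, Matrix.diagonal_mul, mul_comm (g y : ℂ), ← mul_sub,
    ← Complex.ofReal_sub, Complex.normSq_mul, Complex.normSq_ofReal, overlap]
  ring

end NussbaumSzkola

section MomentGenerating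

open Topology Asymptotics

/-- Second-order behaviour at zero of the moment generating function of a centered variable. -/
lemma eventually_mgf_bounds {Ω : Type} [Fintype Ω] (w X : Ω → ℝ) {V : ℝ} (hw : ∑ i, w i = 1)
    (hX : ∑ i, w i * X i = 0) (hV : ∑ i, w i * X i ^ 2 = V) {ε : ℝ} (hε : 0 < ε) :
    ∀ᶠ s in 𝓝 (0 : ℝ), Real.exp ((V / 2 - ε) * s ^ 2) ≤ ∑ i, w i * Real.exp (-s * X i) ∧
      ∑ i, w i * Real.exp (-s * X i) ≤ Real.exp ((V / 2 + ε) * s ^ 2) := by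
  have h1 : (fun s : ℝ => ∑ i, w i * Real.exp (-s * X i) - 1 - V / 2 * s ^ 2) =o[𝓝 0]
      fun s => s ^ 2 := by
    have h2 (i : Ω) : (fun s : ℝ => w i * (Real.exp (-s * X i) -
        ∑ j ∈ Finset.range 3, (-s * X i) ^ j / (j.factorial : ℝ))) =O[𝓝 0] fun s => s ^ 3 := by
      have ht : Tendsto (fun s : ℝ => -s * X i) (𝓝 0) (𝓝 0) := by
        have : Continuous (fun s : ℝ => -s * X i) := by fun_prop
        simpa using this.tendsto 0
      have h3 := ((Real.exp_sub_sum_range_isBigO_pow 3).comp_tendsto ht).const_mul_left (w i)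
      refine h3.trans ?_
      refine IsBigO.of_bound (|X i| ^ 3) (Eventually.of_forall fun s => ?_)
      simp [mul_pow, mul_comm]
    have h4 := (IsBigO.sum fun i (_ : i ∈ (Finset.univ : Finset Ω)) => h2 i).trans_isLittleO
      (isLittleO_pow_pow (𝕜 := ℝ) (show 2 < 3 by norm_num))
    refine h4.congr_left fun s => ?_
    have e : ∀ i, w i * (Real.exp (-s * X i) -
        ∑ j ∈ Finset.range 3, (-s * X i) ^ j / (j.factorial : ℝ)) =
        w i * Real.exp (-s * X i) - w i + s * (w i * X i) - s ^ 2 / 2 * (w i * X i ^ 2) := by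
      intro i
      simp [Finset.sum_range_succ, Nat.factorial]
      ring
    rw [Finset.sum_apply, Finset.sum_congr rfl fun i _ => e i]
    simp only [Finset.sum_add_distrib, Finset.sum_sub_distrib, ← Finset.mul_sum, hw, hX, hV]
    ring
  have h5 : (fun s : ℝ => Real.exp ((V / 2 - ε) * s ^ 2) - 1 - (V / 2 - ε) * s ^ 2) =o[𝓝 0]
      fun s => s ^ 2 := by
    have ht : Tendsto (fun s : ℝ => (V / 2 - ε) * s ^ 2) (𝓝 0) (𝓝 0) := by
      have : Continuous (fun s : ℝ => (V / 2 - ε) * s ^ 2) := by fun_prop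
      simpa using this.tendsto 0
    have h3 := (Real.exp_sub_sum_range_isBigO_pow 2).comp_tendsto ht
    have h4 : (fun s : ℝ => ((V / 2 - ε) * s ^ 2) ^ 2) =O[𝓝 0] fun s => s ^ 4 := by
      refine IsBigO.of_bound ((V / 2 - ε) ^ 2) (Eventually.of_forall fun s => ?_)
      rw [mul_pow, ← pow_mul, norm_mul, Real.norm_of_nonneg (sq_nonneg _)]
    refine ((h3.trans h4).trans_isLittleO
      (isLittleO_pow_pow (𝕜 := ℝ) (show 2 < 4 by norm_num))).congr_left fun s => ?_
    simp [Finset.sum_range_succ]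
    ring
  filter_upwards [h1.bound (half_pos hε), h5.bound (half_pos hε)] with s hs1 hs2
  rw [Real.norm_of_nonneg (sq_nonneg s), Real.norm_eq_abs, abs_le] at hs1 hs2
  have hs : 0 ≤ s ^ 2 * ε := by positivity
  constructor
  · nlinarith [hs1.1, hs2.2]
  · have := Real.add_one_le_exp ((V / 2 + ε) * s ^ 2)
    nlinarith [hs1.2]

end MomentGenerating

section HypothesisTesting

variable {ι : Type} [Fintype ι] [DecidableEq ι]

lemma hypoErr_le {A B Q : Matrix ι ι ℂ} (hA : A.PosSemidef) {μ : ℝ} (hQ : Q.PosSemidef)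
    (hQ' : (1 - Q).PosSemidef) (hμ : reTr (Q * B) ≤ μ) :
    hypoErr A B μ ≤ reTr ((1 - Q) * A) := by
  refine csInf_le ⟨0, ?_⟩ ⟨Q, hQ, hQ', hμ, rfl⟩
  rintro _ ⟨Q, -, hQ', -, rfl⟩
  exact reTr_mul_nonneg hQ' hA

lemma le_hypoErr {A B : Matrix ι ι ℂ} {μ c : ℝ} (hμ : 0 ≤ μ)
    (h : ∀ Q : Matrix ι ι ℂ, Q.PosSemidef → (1 - Q).PosSemidef → reTr (Q * B) ≤ μ →
      c ≤ reTr ((1 - Q) * A)) : c ≤ hypoErr A B μ := by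
  refine le_csInf ⟨_, 0, Matrix.PosSemidef.zero, ?_, ?_, rfl⟩ ?_
  · simpa using Matrix.PosSemidef.one
  · simpa [reTr] using hμ
  · rintro _ ⟨Q, hQ, hQ', hμ, rfl⟩
    exact h Q hQ hQ' hμ

lemma reTr_mul_smul (A B : Matrix ι ι ℂ) (t : ℝ) : reTr (A * (t : ℂ) • B) = t * reTr (A * B) := by
  simp [reTr, Matrix.trace_smul]

variable {d : ℕ} {U W : Matrix (Fin d) (Fin d) ℂ} {l m : Fin d → ℝ}

lemma hypoErr_tensorPow_le (hU : U ∈ Matrix.unitaryGroup (Fin d) ℂ)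
    (hW : W ∈ Matrix.unitaryGroup (Fin d) ℂ) (hl : ∀ i, 0 ≤ l i) (hm : ∀ i, 0 ≤ m i)
    (hlm : ∀ x y, l x ≠ 0 → m y = 0 → overlap U W x y = 0) (n : ℕ) {s τ : ℝ}
    (hs0 : 0 < s) (hs1 : s < 1)
    (h : Real.exp (s * τ) *
      (∑ x, ∑ y, l x * overlap U W x y * Real.exp (-s * (Real.log (l x) - Real.log (m y)))) ^ n
        ≤ 1) :
    hypoErr (tensorPow (conjDiag U l) n) (tensorPow (conjDiag W m) n) (Real.exp (-τ)) ≤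
      Real.exp (s * τ) *
      (∑ x, ∑ y, l x * overlap U W x y * Real.exp (-s * (Real.log (l x) - Real.log (m y)))) ^ n := by
  have hl' (x : Fin n → Fin d) : 0 ≤ ∏ k, l (x k) := Finset.prod_nonneg fun k _ => hl _
  have hm' (x : Fin n → Fin d) : 0 ≤ ∏ k, m (x k) := Finset.prod_nonneg fun k _ => hm _
  obtain ⟨Q, hQ, hQ', herr⟩ := exists_test_error_le (tensorPow_mem_unitaryGroup hU n)
    (tensorPow_mem_unitaryGroup hW n) hl'
    (fun x => mul_nonneg (Real.exp_pos τ).le (hm' x)) (s := s) ⟨hs0.le, hs1.le⟩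
  rw [← smul_conjDiag, ← tensorPow_conjDiag, ← tensorPow_conjDiag, reTr_mul_smul] at herr
  have hA := tensorPow_conjDiag U l n ▸ posSemidef_conjDiag (tensorPow U n) hl'
  have hB := tensorPow_conjDiag W m n ▸ posSemidef_conjDiag (tensorPow W n) hm'
  have hpair (x y : Fin d) : l x ^ (1 - s) * m y ^ s * overlap U W x y =
      l x * overlap U W x y * Real.exp (-s * (Real.log (l x) - Real.log (m y))) := by
    rcases eq_or_lt_of_le (hl x) with hx | hx
    · rw [← hx, Real.zero_rpow (by linarith)]
      simp
    rcases eq_or_lt_of_le (hm y) with hy | hy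
    · rw [hlm x y hx.ne' hy.symm]
      simp
    have h1 : l x * Real.exp (-s * (Real.log (l x) - Real.log (m y))) =
        l x ^ (1 - s) * m y ^ s := by
      rw [Real.rpow_def_of_pos hx, Real.rpow_def_of_pos hy]
      conv_lhs => rw [← Real.exp_log hx, Real.log_exp]
      rw [← Real.exp_add, ← Real.exp_add]
      congr 1; ring
    rw [← h1]; ring
  have hsum : ∑ x : Fin n → Fin d, ∑ y : Fin n → Fin d, (∏ k, l (x k)) ^ (1 - s) *
      (Real.exp τ * ∏ k, m (y k)) ^ s * overlap (tensorPow U n) (tensorPow W n) x y =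
      Real.exp (s * τ) * (∑ x, ∑ y, l x * overlap U W x y *
        Real.exp (-s * (Real.log (l x) - Real.log (m y)))) ^ n := by
    simp only [← hpair]
    rw [← sum_sum_prod, Finset.mul_sum]
    refine Finset.sum_congr rfl fun x _ => ?_
    rw [Finset.mul_sum]
    refine Finset.sum_congr rfl fun y _ => ?_
    rw [Real.mul_rpow (Real.exp_pos τ).le (hm' y), ← Real.exp_mul, overlap_tensorPow,
      ← Real.finsetProd_rpow _ _ (fun k _ => hl _), ← Real.finsetProd_rpow _ _ (fun k _ => hm _),
      Finset.prod_mul_distrib, Finset.prod_mul_distrib, mul_comm s]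
    ring
  rw [hsum] at herr
  have hnn1 := reTr_mul_nonneg hQ' hA
  have hnn2 := reTr_mul_nonneg hQ hB
  have hμ : reTr (Q * tensorPow (conjDiag W m) n) ≤ Real.exp (-τ) := by
    rw [Real.exp_neg, ← one_div, le_div_iff₀' (Real.exp_pos τ)]
    linarith
  refine (hypoErr_le hA hQ hQ' hμ).trans ?_
  have := mul_nonneg (Real.exp_pos τ).le hnn2
  linarith

/-- Chernoff-type minorant of the indicator of `S ≤ -2b`. -/
lemma exp_window_le {S b s δ : ℝ} (hs : 0 ≤ s) (hδ : 0 ≤ δ) :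
    Real.exp (-(4 * b * s)) * (Real.exp (-s * S) - Real.exp (2 * b * δ) *
      Real.exp (-(s - δ) * S) - Real.exp (-(4 * b * δ)) * Real.exp (-(s + δ) * S)) ≤
      if S ≤ -2 * b then 1 else 0 := by
  rw [← Real.exp_add, ← Real.exp_add]
  have p1 := Real.exp_pos (2 * b * δ + -(s - δ) * S)
  have p2 := Real.exp_pos (-(4 * b * δ) + -(s + δ) * S)
  have p0 := Real.exp_pos (-(4 * b * s))
  by_cases h1 : S ≤ -2 * b
  · rw [if_pos h1]
    by_cases h2 : S ≤ -(4 * b)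
    · have : Real.exp (-s * S) ≤ Real.exp (-(4 * b * δ) + -(s + δ) * S) :=
        Real.exp_le_exp.2 (by nlinarith)
      nlinarith
    · have : Real.exp (-(4 * b * s)) * Real.exp (-s * S) ≤ 1 := by
        rw [← Real.exp_add, Real.exp_le_one_iff]
        nlinarith
      nlinarith
  · rw [if_neg h1]
    have : Real.exp (-s * S) ≤ Real.exp (2 * b * δ + -(s - δ) * S) :=
      Real.exp_le_exp.2 (by nlinarith)
    nlinarith

lemma le_hypoErr_tensorPow (hU : U ∈ Matrix.unitaryGroup (Fin d) ℂ)
    (hW : W ∈ Matrix.unitaryGroup (Fin d) ℂ) (hl : ∀ i, 0 ≤ l i) (hm : ∀ i, 0 ≤ m i)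
    (hlm : ∀ x y, l x ≠ 0 → m y = 0 → overlap U W x y = 0) (n : ℕ) {s δ a D μ : ℝ}
    (hs : 0 ≤ s) (hδ : 0 ≤ δ) (hμ : 0 ≤ μ) {M : ℝ → ℝ}
    (hM : ∀ r, M r = ∑ x, ∑ y, l x * overlap U W x y *
      Real.exp (-r * (Real.log (l x) - Real.log (m y) - D))) :
    Real.exp (-(4 * (n * a) * s)) * (M s ^ n - Real.exp (2 * (n * a) * δ) * M (s - δ) ^ n -
      Real.exp (-(4 * (n * a) * δ)) * M (s + δ) ^ n) / 2 - Real.exp (n * (D - 2 * a)) * μ ≤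
      hypoErr (tensorPow (conjDiag U l) n) (tensorPow (conjDiag W m) n) μ := by
  have hl' (x : Fin n → Fin d) : 0 ≤ ∏ k, l (x k) := Finset.prod_nonneg fun k _ => hl _
  have hm' (x : Fin n → Fin d) : 0 ≤ ∏ k, m (x k) := Finset.prod_nonneg fun k _ => hm _
  set t := Real.exp (n * (D - 2 * a)) with ht
  have ht0 : 0 < t := Real.exp_pos _
  refine le_hypoErr hμ fun Q hQ hQ' hQμ => ?_
  have herr := sum_min_le_test_error (tensorPow_mem_unitaryGroup hU n)
    (tensorPow_mem_unitaryGroup hW n) hl' (fun x => mul_nonneg ht0.le (hm' x)) hQ hQ'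
  rw [← smul_conjDiag, ← tensorPow_conjDiag, ← tensorPow_conjDiag, reTr_mul_smul] at herr
  let S (x y : Fin n → Fin d) : ℝ := ∑ k, (Real.log (l (x k)) - Real.log (m (y k)) - D)
  let w (x y : Fin n → Fin d) : ℝ := ∏ k, (l (x k) * overlap U W (x k) (y k))
  have hw (x y : Fin n → Fin d) : 0 ≤ w x y :=
    Finset.prod_nonneg fun k _ => mul_nonneg (hl _) (overlap_nonneg _ _ _ _)
  have hMn (r : ℝ) : M r ^ n = ∑ x, ∑ y, w x y * Real.exp (-r * S x y) := by
    rw [hM, ← sum_sum_prod]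
    refine Finset.sum_congr rfl fun x _ => Finset.sum_congr rfl fun y _ => ?_
    rw [Finset.prod_mul_distrib, Finset.mul_sum, Real.exp_sum]
  have hwin : Real.exp (-(4 * (n * a) * s)) * (M s ^ n - Real.exp (2 * (n * a) * δ) *
      M (s - δ) ^ n - Real.exp (-(4 * (n * a) * δ)) * M (s + δ) ^ n) ≤
      ∑ x : Fin n → Fin d, ∑ y : Fin n → Fin d, min (∏ k, l (x k)) (t * ∏ k, m (y k)) *
        overlap (tensorPow U n) (tensorPow W n) x y := by
    rw [hMn, hMn, hMn]
    simp only [Finset.mul_sum, ← Finset.sum_sub_distrib]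
    refine Finset.sum_le_sum fun x _ => Finset.sum_le_sum fun y _ => ?_
    have h1 := mul_le_mul_of_nonneg_left
      (exp_window_le (S := S x y) (b := n * a) hs hδ) (hw x y)
    refine le_trans (le_of_eq (by ring)) (h1.trans ?_)
    have hnn : 0 ≤ min (∏ k, l (x k)) (t * ∏ k, m (y k)) *
        overlap (tensorPow U n) (tensorPow W n) x y :=
      mul_nonneg (le_min (hl' x) (mul_nonneg ht0.le (hm' y))) (overlap_nonneg _ _ _ _)
    split_ifs with hS
    swap
    · rwa [mul_zero]
    rw [mul_one]
    rcases (hw x y).eq_or_lt with h0 | h0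
    · rwa [← h0]
    have hne (k : Fin n) : l (x k) * overlap U W (x k) (y k) ≠ 0 :=
      Finset.prod_ne_zero_iff.1 h0.ne' k (Finset.mem_univ k)
    have hlk (k : Fin n) : 0 < l (x k) := lt_of_le_of_ne (hl _) (left_ne_zero_of_mul (hne k)).symm
    have hmk (k : Fin n) : 0 < m (y k) := lt_of_le_of_ne (hm _) fun h =>
      right_ne_zero_of_mul (hne k) (hlm _ _ (hlk k).ne' h.symm)
    have hle : ∏ k, l (x k) ≤ t * ∏ k, m (y k) := by
      have e1 : ∏ k, l (x k) = Real.exp (∑ k, Real.log (l (x k))) := by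
        rw [Real.exp_sum]
        exact Finset.prod_congr rfl fun k _ => (Real.exp_log (hlk k)).symm
      have e2 : ∏ k, m (y k) = Real.exp (∑ k, Real.log (m (y k))) := by
        rw [Real.exp_sum]
        exact Finset.prod_congr rfl fun k _ => (Real.exp_log (hmk k)).symm
      rw [e1, e2, ht, ← Real.exp_add, Real.exp_le_exp]
      have e3 : S x y = ∑ k, Real.log (l (x k)) - ∑ k, Real.log (m (y k)) - n * D := by
        simp [S, Finset.sum_sub_distrib]
      rw [e3] at hS
      linarith
    rw [min_eq_left hle, overlap_tensorPow, ← Finset.prod_mul_distrib]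
  have := mul_le_mul_of_nonneg_left hQμ ht0.le
  linarith

end HypothesisTesting

section ModerateDeviation

open Topology

/-- Spectral data of a pair of density operators with `supp ρ ⊆ supp σ`, together with the
variance of the centered log-likelihood ratio of the Nussbaum–Szkoła pair. -/
lemma exists_nussbaumSzkola {d : ℕ} {ρ σ : Matrix (Fin d) (Fin d) ℂ} (hρ : IsDensity ρ)
    (hσ : IsDensity σ) (hsupp : SuppLE ρ σ) :
    ∃ U ∈ Matrix.unitaryGroup (Fin d) ℂ, ∃ W ∈ Matrix.unitaryGroup (Fin d) ℂ,
      ∃ l m : Fin d → ℝ, ρ = conjDiag U l ∧ σ = conjDiag W m ∧ (∀ i, 0 ≤ l i) ∧ (∀ i, 0 ≤ m i) ∧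
        (∀ x y, l x ≠ 0 → m y = 0 → overlap U W x y = 0) ∧
        ∑ x, ∑ y, l x * overlap U W x y = 1 ∧
        ∑ x, ∑ y, l x * overlap U W x y * (Real.log (l x) - Real.log (m y) - qD ρ σ) = 0 ∧
        ∑ x, ∑ y, l x * overlap U W x y * (Real.log (l x) - Real.log (m y) - qD ρ σ) ^ 2 =
          qV ρ σ := by
  obtain ⟨U, hU, hρU, hUf⟩ := hρ.1.isHermitian.exists_eq_conjDiag
  obtain ⟨W, hW, hσW, hWf⟩ := hσ.1.isHermitian.exists_eq_conjDiag
  have hl := hρ.1.eigenvalues_nonneg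
  have hm := hσ.1.eigenvalues_nonneg
  have hlogρ : mlog ρ = conjDiag U fun i => Real.log (hρ.1.isHermitian.eigenvalues i) := by
    rw [mlog, matFun, dif_pos hρ.1.isHermitian, hUf]
  have hlogσ : mlog σ = conjDiag W fun i => Real.log (hσ.1.isHermitian.eigenvalues i) := by
    rw [mlog, matFun, dif_pos hσ.1.isHermitian, hWf]
  set l := hρ.1.isHermitian.eigenvalues
  set m := hσ.1.isHermitian.eigenvalues
  have hD : qD ρ σ = ∑ x, ∑ y, l x * overlap U W x y * (Real.log (l x) - Real.log (m y)) := by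
    rw [qD, hlogρ, hlogσ, ← reTr_mul_sub_conjDiag hU hW, ← hρU]
  have hV : qV ρ σ + qD ρ σ ^ 2 =
      ∑ x, ∑ y, l x * overlap U W x y * (Real.log (l x) - Real.log (m y)) ^ 2 := by
    rw [qV, hlogρ, hlogσ, ← reTr_mul_sub_sq_conjDiag hU hW, ← hρU, sub_add_cancel]
  have h1 : ∑ x, ∑ y, l x * overlap U W x y = 1 := by
    have := reTr_conjDiag_mul_conjDiag U W l fun _ => 1
    rw [conjDiag_one hW, Matrix.mul_one, ← hρU, reTr, hρ.2, Complex.one_re] at this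
    simpa only [mul_one] using this.symm
  refine ⟨U, hU, W, hW, l, m, hρU, hσW, hl, hm,
    fun x y hx hy => overlap_eq_zero_of_suppLE hU hW (hρU ▸ hσW ▸ hsupp) hx hy, h1, ?_, ?_⟩
  · simp only [mul_sub _ _ (qD ρ σ), Finset.sum_sub_distrib, ← hD, ← Finset.sum_mul, h1]
    ring
  · have e (x y : Fin d) :
        l x * overlap U W x y * (Real.log (l x) - Real.log (m y) - qD ρ σ) ^ 2 =
        l x * overlap U W x y * (Real.log (l x) - Real.log (m y)) ^ 2 -
          l x * overlap U W x y * (Real.log (l x) - Real.log (m y)) * (2 * qD ρ σ) +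
          l x * overlap U W x y * qD ρ σ ^ 2 := by ring
    simp only [e, Finset.sum_add_distrib, Finset.sum_sub_distrib, ← Finset.sum_mul, h1, ← hD,
      ← hV]
    ring

/-- The window estimate of the converse, with all exponents in units of `N = n a² / V`. -/
lemma exp_neg_le_window {N p q r t κ : ℝ} (hN : 8 ≤ N) (hp : Real.exp (4.41 * N) ≤ p)
    (hq : q ≤ Real.exp (4.04 * N)) (hr : r ≤ Real.exp (4.16 * N)) (hκ : κ = 12 * N)
    (ht : t ≤ Real.exp (-(14 * N))) :
    Real.exp (-(13 * N)) ≤ Real.exp (-κ) * (p - q - r) / 2 - t := by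
  have h1 : 3 * Real.exp (4.16 * N) ≤ Real.exp (4.41 * N) := by
    have : Real.exp (4.41 * N) = Real.exp (0.25 * N) * Real.exp (4.16 * N) := by
      rw [← Real.exp_add]; congr 1; ring
    rw [this]
    gcongr
    linarith [Real.add_one_le_exp (0.25 * N)]
  have h2 : Real.exp (4.04 * N) ≤ Real.exp (4.16 * N) := Real.exp_le_exp.2 (by linarith)
  have h3 : 1 ≤ Real.exp (4.16 * N) := Real.one_le_exp (by linarith)
  have h4 : 4 * Real.exp (-(13 * N)) ≤ Real.exp (-(12 * N)) := by
    have : Real.exp (-(12 * N)) = Real.exp N * Real.exp (-(13 * N)) := by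
      rw [← Real.exp_add]; congr 1; ring
    rw [this]
    gcongr
    linarith [Real.add_one_le_exp N]
  have h5 : Real.exp (-(14 * N)) ≤ Real.exp (-(13 * N)) := Real.exp_le_exp.2 (by linarith)
  have h6 : Real.exp (-(12 * N)) * 1 ≤ Real.exp (-(12 * N)) * (p - q - r) := by
    gcongr
    linarith
  rw [hκ]
  linarith

end ModerateDeviation

/-- **Moderate deviation achievability for quantum hypothesis testing.** -/
theorem moderate_deviation_achievability_HT
    {d : ℕ} (ρ σ : Matrix (Fin d) (Fin d) ℂ)
    (hρ : IsDensity ρ) (hσ : IsDensity σ) (hsupp : SuppLE ρ σ)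
    (hV : 0 < qV ρ σ)
    (a : ℕ → ℝ)
    (ha0 : Filter.Tendsto a Filter.atTop (nhds 0))
    (ha1 : Filter.Tendsto (fun n : ℕ => a n * Real.sqrt n) Filter.atTop Filter.atTop) :
    Filter.limsup (fun n : ℕ => (1 / ((n : ℝ) * (a n) ^ 2)) *
        Real.log (hypoErr (tensorPow ρ n) (tensorPow σ n)
          (Real.exp (-(n : ℝ) * (qD ρ σ - a n))))) Filter.atTop ≤
      -1 / (2 * qV ρ σ) := by
  obtain ⟨U, hU, W, hW, l, m, hρU, hσW, hl, hm, hlm, hw1, hwX, hwV⟩ :=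
    exists_nussbaumSzkola hρ hσ hsupp
  set V := qV ρ σ
  set D := qD ρ σ
  set M : ℝ → ℝ := fun r => ∑ x, ∑ y, l x * overlap U W x y *
    Real.exp (-r * (Real.log (l x) - Real.log (m y) - D)) with hM
  have hMpos (r : ℝ) : 0 ≤ M r := Finset.sum_nonneg fun x _ => Finset.sum_nonneg fun y _ =>
    mul_nonneg (mul_nonneg (hl x) (overlap_nonneg _ _ _ _)) (Real.exp_pos _).le
  have hMbound {ε : ℝ} (hε : 0 < ε) : ∀ᶠ s in nhds (0 : ℝ),
      Real.exp ((V / 2 - ε) * s ^ 2) ≤ M s ∧ M s ≤ Real.exp ((V / 2 + ε) * s ^ 2) := by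
    have := eventually_mgf_bounds (fun i : Fin d × Fin d => l i.1 * overlap U W i.1 i.2)
      (fun i => Real.log (l i.1) - Real.log (m i.2) - D) (V := V)
      (by rw [Fintype.sum_prod_type]; exact hw1) (by rw [Fintype.sum_prod_type]; exact hwX)
      (by rw [Fintype.sum_prod_type]; exact hwV) hε
    simpa only [Fintype.sum_prod_type] using this
  have hscale (c : ℝ) : Tendsto (fun n => c * (a n / V)) atTop (nhds 0) := by
    simpa using (ha0.div_const V).const_mul c
  have hNtop : Tendsto (fun n : ℕ => (n : ℝ) * a n ^ 2 / V) atTop atTop := by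
    have h := (ha1.atTop_mul_atTop₀ ha1).atTop_div_const hV
    refine h.congr fun n => ?_
    rw [mul_mul_mul_comm, Real.mul_self_sqrt n.cast_nonneg]
    ring
  have hapos : ∀ᶠ n in atTop, 0 < a n := by
    filter_upwards [ha1.eventually_gt_atTop 0] with n hn
    exact pos_of_mul_pos_left hn (Real.sqrt_nonneg _)
  have hasmall : ∀ᶠ n in atTop, a n < V / 14 := ha0.eventually_lt_const (by positivity)
  set α : ℕ → ℝ := fun n => hypoErr (tensorPow ρ n) (tensorPow σ n)
    (Real.exp (-(n : ℝ) * (D - a n))) with hα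
  have hlower : ∀ᶠ n : ℕ in atTop, Real.exp (-(13 * ((n : ℝ) * a n ^ 2 / V))) ≤ α n := by
    have hb := hMbound (show 0 < V / 100 by positivity)
    filter_upwards [(hscale 3).eventually hb, (hscale 2).eventually hb, (hscale 4).eventually hb,
      hNtop.eventually_ge_atTop 8, hapos, hasmall] with n h3 h2 h4 hN ha has
    have hmain := le_hypoErr_tensorPow hU hW hl hm hlm n (s := 3 * (a n / V)) (δ := a n / V)
      (a := a n) (D := D) (μ := Real.exp (-(n : ℝ) * (D - a n))) (M := M) (by positivity)
      (by positivity) (Real.exp_pos _).le fun r => rfl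
    rw [← hρU, ← hσW] at hmain
    refine le_trans (exp_neg_le_window hN ?_ ?_ ?_ ?_ ?_) hmain
    · calc _ = Real.exp ((V / 2 - V / 100) * (3 * (a n / V)) ^ 2) ^ n := by
            rw [← Real.exp_nat_mul]; congr 1; field_simp; ring
        _ ≤ _ := pow_le_pow_left₀ (Real.exp_pos _).le h3.1 n
    · rw [show 3 * (a n / V) - a n / V = 2 * (a n / V) by ring]
      calc _ ≤ Real.exp (2 * (n * a n) * (a n / V)) *
              Real.exp ((V / 2 + V / 100) * (2 * (a n / V)) ^ 2) ^ n := by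
            gcongr
            · exact hMpos _
            · exact h2.2
        _ = _ := by
            rw [← Real.exp_nat_mul, ← Real.exp_add]; congr 1; field_simp; ring
    · rw [show 3 * (a n / V) + a n / V = 4 * (a n / V) by ring]
      calc _ ≤ Real.exp (-(4 * (n * a n) * (a n / V))) *
              Real.exp ((V / 2 + V / 100) * (4 * (a n / V)) ^ 2) ^ n := by
            gcongr
            · exact hMpos _
            · exact h4.2
        _ = _ := by
            rw [← Real.exp_nat_mul, ← Real.exp_add]; congr 1; field_simp; ring
    · ring
    · rw [← Real.exp_add, Real.exp_le_exp]
      have : 14 * ((n : ℝ) * a n ^ 2 / V) ≤ n * a n := by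
        rw [← mul_div_assoc, div_le_iff₀ hV]
        have : (n : ℝ) * a n * a n ≤ n * a n * (V / 14) := by gcongr
        linarith
      linarith
  have hupper {ε : ℝ} (hε : 0 < ε) (hεV : ε < V / 2) : ∀ᶠ n : ℕ in atTop,
      α n ≤ Real.exp ((-1 / (2 * V) + ε / V ^ 2) * (n * a n ^ 2)) := by
    filter_upwards [(hscale 1).eventually (hMbound hε), hapos,
      (hscale 1).eventually_lt_const one_pos] with n hn ha has
    rw [one_mul] at hn has
    have hF : ∑ x, ∑ y, l x * overlap U W x y *
        Real.exp (-(a n / V) * (Real.log (l x) - Real.log (m y))) =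
        Real.exp (-(a n / V) * D) * M (a n / V) := by
      simp only [hM, Finset.mul_sum]
      refine Finset.sum_congr rfl fun x _ => Finset.sum_congr rfl fun y _ => ?_
      rw [mul_left_comm, ← Real.exp_add]
      congr 2; ring
    have hbound : Real.exp (a n / V * (n * (D - a n))) *
        (∑ x, ∑ y, l x * overlap U W x y *
          Real.exp (-(a n / V) * (Real.log (l x) - Real.log (m y)))) ^ n ≤
        Real.exp ((-1 / (2 * V) + ε / V ^ 2) * (n * a n ^ 2)) := by
      rw [hF, mul_pow]
      calc _ ≤ Real.exp (a n / V * (n * (D - a n))) * (Real.exp (-(a n / V) * D) ^ n *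
              Real.exp ((V / 2 + ε) * (a n / V) ^ 2) ^ n) := by
            gcongr
            · exact hMpos _
            · exact hn.2
        _ = _ := by
            rw [← Real.exp_nat_mul, ← Real.exp_nat_mul, ← Real.exp_add, ← Real.exp_add]
            congr 1; field_simp; ring
    have hneg : -1 / (2 * V) + ε / V ^ 2 ≤ 0 := by
      rw [div_add_div _ _ (by positivity) (by positivity)]
      apply div_nonpos_of_nonpos_of_nonneg _ (by positivity)
      nlinarith
    have hle := hypoErr_tensorPow_le hU hW hl hm hlm n (s := a n / V) (τ := n * (D - a n))
      (by positivity) has (hbound.trans (Real.exp_le_one_iff.2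
        (mul_nonpos_of_nonpos_of_nonneg hneg (by positivity))))
    rw [← hρU, ← hσW, ← neg_mul] at hle
    exact hle.trans hbound
  have hcobdd : IsCoboundedUnder (· ≤ ·) atTop fun n : ℕ =>
      (1 / ((n : ℝ) * (a n) ^ 2)) * Real.log (α n) := by
    refine IsBoundedUnder.isCoboundedUnder_le ⟨-13 / V, ?_⟩
    rw [eventually_map]
    filter_upwards [hlower, hNtop.eventually_gt_atTop 0] with n hn hN
    have hna : 0 < (n : ℝ) * a n ^ 2 := by
      have := mul_pos hN hV
      rwa [div_mul_cancel₀ _ hV.ne'] at this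
    have := (Real.le_log_iff_exp_le ((Real.exp_pos _).trans_le hn)).2 hn
    change -13 / V ≤ _
    rw [one_div_mul_eq_div, le_div_iff₀ hna]
    exact le_trans (le_of_eq (by ring)) this
  refine le_of_forall_pos_le_add fun η hη => ?_
  set ε := min (η * V ^ 2) (V / 4)
  have hε : 0 < ε := by positivity
  have hεV : ε < V / 2 := (min_le_right _ _).trans_lt (by linarith)
  refine limsup_le_of_le hcobdd ?_
  filter_upwards [hlower, hupper hε hεV, hNtop.eventually_gt_atTop 0] with n hn hn' hN
  have hna : 0 < (n : ℝ) * a n ^ 2 := by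
    have := mul_pos hN hV
    rwa [div_mul_cancel₀ _ hV.ne'] at this
  have h1 := (Real.log_le_iff_le_exp ((Real.exp_pos _).trans_le hn)).2 hn'
  have h2 : ε / V ^ 2 ≤ η := by
    rw [div_le_iff₀ (by positivity)]
    exact min_le_left _ _
  rw [one_div_mul_eq_div, div_le_iff₀ hna]
  refine h1.trans ?_
  gcongr

end MDQ
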